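/- Let q be a prime power, F the finite field with q elements, n ≥ 2 an integer, and δ ∈ [0,(q-1)/q). The rate R of every all-disjoint linearly recoverable (δ,n)-LRC sequence over F satisfies the sphere-packing bound R ≤ R_SP(δ,n) := R_0(δ/2, n). -/

import Mathlib

open Filter Set

noncomputable section

/-- Minimum (Hamming) distance of a code. -/
def minDist {K : Type} [DecidableEq K] {ι : Type} [Fintype ι] (C : Set (ι → K)) : ℕ :=
  sInf {d : ℕ | ∃ c ∈ C, ∃ c' ∈ C, c ≠ c' ∧ hammingDist c c' = d}

/-- `Rg` exhibits `C` as a linearly recoverable LRC with locality `n - 1`. -/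
def IsLinRecLRC {K : Type} [Field K] {N : ℕ} (C : Set (Fin N → K)) (n : ℕ)
    (Rg : Fin N → Finset (Fin N)) : Prop :=
  ∀ j : Fin N, j ∈ Rg j ∧ (Rg j).card ≤ n ∧
    ∃ a : Fin N → K, (∀ i, i ∉ (Rg j).erase j → a i = 0) ∧
      ∀ c ∈ C, c j = ∑ i, a i * c i

/-- The distinct members of the list of repair groups `Rg` form a partition of the
coordinate set. -/
def IsAllDisjoint {N : ℕ} (Rg : Fin N → Finset (Fin N)) : Prop :=
  ∀ j j' : Fin N, Rg j = Rg j' ∨ Disjoint (Rg j) (Rg j')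

/-- `λ_q(ω,n)`. -/
def lambdaQ (q : ℕ) (ω : ℝ) (n : ℕ) : ℝ :=
  ⨅ z : Set.Ioc (0:ℝ) 1,
    (-ω * Real.logb q (z : ℝ) - 1 / n +
      (1 / n) * Real.logb q ((1 + ((q:ℝ) - 1) * (z:ℝ)) ^ n + ((q:ℝ) - 1) * (1 - (z:ℝ)) ^ n))

/-- `R_0(ω,n) = (n-1)/n - λ_q(ω,n)`. -/
def R0 (q : ℕ) (ω : ℝ) (n : ℕ) : ℝ := ((n:ℝ) - 1) / n - lambdaQ q ω n

set_option linter.unusedSectionVars false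

section WeightEnumerator

variable {K ι G : Type} [Field K] [Fintype K] [DecidableEq K] [Fintype ι]

/-- The weight enumerator `∑ z ^ wt x` of a finite code. -/
def weightEnum (A : Finset (ι → K)) (z : ℝ) : ℝ := ∑ x ∈ A, z ^ hammingNorm x

open scoped Classical in
/-- The code cut out by the single linear equation `∑ β i * x i = 0`. -/
def parityCode (β : ι → K) : Finset (ι → K) := Finset.univ.filter fun x => ∑ i, β i * x i = 0

open scoped Classical in
/-- The direct sum, over the fibres of `g`, of the parity codes given by the restrictions of `β`. -/
def blockParityCode [Fintype G] [DecidableEq G] (g : ι → G) (β : ι → K) : Finset (ι → K) :=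
  Finset.univ.filter fun x => ∀ k,
    (fun i : {i // g i = k} => x i) ∈ parityCode fun i : {i // g i = k} => β i

theorem mem_parityCode {β x : ι → K} : x ∈ parityCode β ↔ ∑ i, β i * x i = 0 := by
  simp [parityCode]

theorem pow_hammingNorm_eq_prod {R : Type} [CommSemiring R] (z : R) (x : ι → K) :
    z ^ hammingNorm x = ∏ i, if x i = 0 then 1 else z := by
  simp [hammingNorm, Finset.prod_ite]

theorem addChar_sum_eq_prod (ψ : AddChar K ℂ) (f : ι → K) : ψ (∑ i, f i) = ∏ i, ψ (f i) := by
  classical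
  induction (Finset.univ : Finset ι) using Finset.induction_on with
  | empty => simp
  | insert a s ha ih => rw [Finset.sum_insert ha, Finset.prod_insert ha, AddChar.map_add_eq_mul, ih]

theorem sum_addChar_mul_ite {ψ : AddChar K ℂ} (hψ : ψ.IsPrimitive) (b : K) (z : ℂ) :
    ∑ c, ψ (c * b) * (if c = 0 then 1 else z) =
      if b = 0 then 1 + ((Fintype.card K : ℂ) - 1) * z else 1 - z := by
  have h : ∀ c : K, ψ (c * b) * (if c = 0 then 1 else z) =
      z * ψ (c * b) + if c = 0 then 1 - z else 0 := by
    intro c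
    split_ifs with hc
    · simp [hc]
    · ring
  simp_rw [h, Finset.sum_add_distrib, ← Finset.mul_sum, AddChar.sum_mulShift b hψ]
  split_ifs <;> simp
  ring

theorem card_mul_weightEnum_parityCode (β : ι → K) (z : ℝ) :
    (Fintype.card K : ℝ) * weightEnum (parityCode β) z =
      (1 + ((Fintype.card K : ℝ) - 1) * z) ^ Fintype.card ι +
      ((Fintype.card K : ℝ) - 1) * ((1 + ((Fintype.card K : ℝ) - 1) * z) ^
        (Fintype.card ι - hammingNorm β) * (1 - z) ^ hammingNorm β) := by
  classical
  set ψ := AddChar.FiniteField.primitiveChar_to_Complex K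
  have hψ : ψ.IsPrimitive := AddChar.FiniteField.primitiveChar_to_Complex_isPrimitive K
  have key : ∀ b : K, ∑ x : ι → K, ψ (b * ∑ i, β i * x i) * (z : ℂ) ^ hammingNorm x =
      ∏ i, if β i * b = 0 then 1 + ((Fintype.card K : ℂ) - 1) * z else 1 - (z : ℂ) := by
    intro b
    simp_rw [← sum_addChar_mul_ite hψ, Fintype.prod_sum, Finset.prod_mul_distrib,
      ← pow_hammingNorm_eq_prod, ← addChar_sum_eq_prod, Finset.mul_sum]
    refine Finset.sum_congr rfl fun x _ => ?_
    congr 2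
    exact Finset.sum_congr rfl fun i _ => by ring
  have h1 : ∑ b : K, ∑ x : ι → K, ψ (b * ∑ i, β i * x i) * (z : ℂ) ^ hammingNorm x =
      (Fintype.card K : ℂ) * ∑ x ∈ parityCode β, (z : ℂ) ^ hammingNorm x := by
    rw [Finset.sum_comm]
    simp_rw [← Finset.sum_mul, AddChar.sum_mulShift _ hψ, parityCode, Finset.sum_filter,
      Finset.mul_sum]
    refine Finset.sum_congr rfl fun x _ => ?_
    split_ifs <;> simp
  have h2 : ∀ b : K, b ≠ 0 →
      (∏ i, if β i * b = 0 then 1 + ((Fintype.card K : ℂ) - 1) * z else 1 - (z : ℂ)) =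
      (1 + ((Fintype.card K : ℂ) - 1) * z) ^ (Fintype.card ι - hammingNorm β) *
        (1 - (z : ℂ)) ^ hammingNorm β := by
    intro b hb
    simp only [mul_eq_zero, hb, or_false]
    rw [Finset.prod_ite, Finset.prod_const, Finset.prod_const]
    congr 2
    have := Finset.card_filter_add_card_filter_not (s := (Finset.univ : Finset ι))
      (fun i => β i = 0)
    rw [Finset.card_univ] at this
    change _ = _ - (Finset.univ.filter fun i => β i ≠ 0).card
    simp only [ne_eq]
    omega
  simp_rw [key] at h1
  rw [← Finset.add_sum_erase _ _ (Finset.mem_univ (0 : K)),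
    Finset.sum_congr rfl (fun b hb => h2 b (Finset.ne_of_mem_erase hb)), Finset.sum_const,
    Finset.card_erase_of_mem (Finset.mem_univ _), Finset.card_univ, nsmul_eq_mul,
    Nat.cast_sub Fintype.card_pos] at h1
  simp only [mul_zero, if_true, Finset.prod_const, Finset.card_univ, Nat.cast_one] at h1
  rw [weightEnum]
  exact_mod_cast h1.symm

theorem hammingNorm_eq_sum_fiber [Fintype G] [DecidableEq G] (g : ι → G) (x : ι → K) :
    hammingNorm x = ∑ k, hammingNorm fun i : {i // g i = k} => x i := by
  classical
  have h : ∀ {κ : Type} [Fintype κ] (y : κ → K), hammingNorm y = ∑ i, if y i = 0 then 0 else 1 := by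
    intro κ _ y
    simp [hammingNorm, Finset.sum_ite]
  simp_rw [h]
  rw [← (Equiv.sigmaFiberEquiv g).sum_comp, Fintype.sum_sigma]
  rfl

theorem weightEnum_blockParityCode [Fintype G] [DecidableEq G] (g : ι → G) (β : ι → K) (z : ℝ) :
    weightEnum (blockParityCode g β) z =
      ∏ k, weightEnum (parityCode fun i : {i // g i = k} => β i) z := by
  classical
  simp_rw [weightEnum]
  rw [Finset.prod_univ_sum]
  let e : (ι → K) ≃ ((k : G) → {i // g i = k} → K) :=
    ((Equiv.sigmaFiberEquiv g).symm.arrowCongr (Equiv.refl K)).trans (Equiv.piCurry fun _ _ => K)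
  refine Finset.sum_equiv e (fun x => ?_) fun x _ => ?_
  · simp only [blockParityCode, Finset.mem_filter, Finset.mem_univ, true_and, Fintype.mem_piFinset]
    rfl
  · rw [hammingNorm_eq_sum_fiber g, Finset.prod_pow_eq_pow_sum]
    rfl

theorem weightEnum_one (A : Finset (ι → K)) : weightEnum A 1 = A.card := by simp [weightEnum]

theorem zero_mem_parityCode (β : ι → K) : (0 : ι → K) ∈ parityCode β := by simp [mem_parityCode]

theorem one_le_weightEnum_parityCode (β : ι → K) {z : ℝ} (hz : 0 ≤ z) :
    1 ≤ weightEnum (parityCode β) z := by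
  have := Finset.single_le_sum (f := fun x : ι → K => z ^ hammingNorm x)
    (fun x _ => pow_nonneg hz _) (zero_mem_parityCode β)
  simpa [weightEnum] using this

theorem weightEnum_le (A : Finset (ι → K)) {z : ℝ} (hz : 0 ≤ z) :
    weightEnum A z ≤ (1 + ((Fintype.card K : ℝ) - 1) * z) ^ Fintype.card ι := by
  classical
  calc weightEnum A z ≤ weightEnum Finset.univ z :=
        Finset.sum_le_sum_of_subset_of_nonneg (Finset.subset_univ _) fun _ _ _ => pow_nonneg hz _
    _ = (∑ c : K, if c = 0 then 1 else z) ^ Fintype.card ι := by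
        simp_rw [weightEnum, pow_hammingNorm_eq_prod]
        rw [← Finset.card_univ, ← Finset.prod_const, Fintype.prod_sum]
    _ = _ := by
        congr 1
        rw [← Finset.add_sum_erase _ _ (Finset.mem_univ (0 : K)),
          Finset.sum_congr rfl (fun b hb => if_neg (Finset.ne_of_mem_erase hb)), Finset.sum_const,
          Finset.card_erase_of_mem (Finset.mem_univ _), Finset.card_univ, nsmul_eq_mul,
          Nat.cast_sub Fintype.card_pos]
        simp

end WeightEnumerator

section BlockBounds

variable {K ι G : Type} [Field K] [Fintype K] [DecidableEq K] [Fintype ι]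

/-- `q` times the weight enumerator of a full-support parity code of length `n`. -/
def parityPoly (q n : ℕ) (z : ℝ) : ℝ :=
  (1 + ((q : ℝ) - 1) * z) ^ n + ((q : ℝ) - 1) * (1 - z) ^ n

theorem one_le_parityPoly {q : ℕ} (hq : 1 ≤ q) (n : ℕ) {z : ℝ} (hz : z ∈ Set.Ioc (0 : ℝ) 1) :
    1 ≤ parityPoly q n z := by
  have hq' : (0 : ℝ) ≤ (q : ℝ) - 1 := sub_nonneg.2 (by exact_mod_cast hq)
  have h1 : 1 ≤ (1 + ((q : ℝ) - 1) * z) ^ n :=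
    one_le_pow₀ (by nlinarith [mul_nonneg hq' hz.1.le])
  have h2 : 0 ≤ ((q : ℝ) - 1) * (1 - z) ^ n :=
    mul_nonneg hq' (pow_nonneg (sub_nonneg.2 hz.2) _)
  rw [parityPoly]
  linarith

theorem log_parityPoly_le_log_weightEnum_parityCode {n : ℕ} (hn : 0 < n) (β : ι → K)
    (hcard : Fintype.card ι ≤ n) (hβ : Nonempty ι → β ≠ 0) {z : ℝ} (hz : z ∈ Set.Ioc (0 : ℝ) 1) :
    (Fintype.card ι : ℝ) * (Real.log (parityPoly (Fintype.card K) n z) / n -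
        Real.log (Fintype.card K)) ≤
      Real.log (weightEnum (parityCode β) z) - Real.log (weightEnum (parityCode β) 1) := by
  rcases isEmpty_or_nonempty ι with hι | hι
  · simp [weightEnum, hammingNorm]
  have hs : 0 < hammingNorm β := hammingNorm_pos_iff.2 (hβ hι)
  have hsm : hammingNorm β ≤ Fintype.card ι := hammingNorm_le_card_fintype
  have hWz := card_mul_weightEnum_parityCode β z
  have hW1 := card_mul_weightEnum_parityCode β 1
  have hWzpos := one_le_weightEnum_parityCode β hz.1.le
  have hW1pos := one_le_weightEnum_parityCode β zero_le_one
  have hqn : 1 < Fintype.card K := Fintype.one_lt_card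
  rw [parityPoly]
  set m := Fintype.card ι
  set s := hammingNorm β
  have hq : (1 : ℝ) < Fintype.card K := by exact_mod_cast hqn
  set q : ℝ := ((Fintype.card K : ℕ) : ℝ)
  set Q : ℝ := 1 + (q - 1) * z with hQ
  have hQ1 : 1 ≤ Q := by nlinarith [mul_nonneg (sub_nonneg.2 hq.le) hz.1.le]
  have hQ0 : 0 < Q := by linarith
  set u : ℝ := (1 - z) / Q with hu
  have hu0 : 0 ≤ u := div_nonneg (sub_nonneg.2 hz.2) hQ0.le
  have hu1 : u ≤ 1 := by rw [hu, div_le_one hQ0]; linarith [hz.1]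
  have huQ : 1 - z = Q * u := by rw [hu]; field_simp
  have e1 : q * weightEnum (parityCode β) z = Q ^ m * (1 + (q - 1) * u ^ s) := by
    rw [hWz, huQ, mul_pow, ← mul_assoc (Q ^ (m - s)), ← pow_add, Nat.sub_add_cancel hsm]
    ring
  have e2 : q * weightEnum (parityCode β) 1 = q ^ m := by
    rw [hW1, sub_self, zero_pow hs.ne']
    ring
  have e3 : Q ^ n + (q - 1) * (1 - z) ^ n = Q ^ n * (1 + (q - 1) * u ^ n) := by
    rw [huQ, mul_pow]
    ring
  have hpn : 1 ≤ 1 + (q - 1) * u ^ n := by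
    linarith [mul_nonneg (sub_nonneg.2 hq.le) (pow_nonneg hu0 n)]
  have hps : 1 + (q - 1) * u ^ n ≤ 1 + (q - 1) * u ^ s := by
    have := mul_le_mul_of_nonneg_left (pow_le_pow_of_le_one hu0 hu1 (hsm.trans hcard))
      (sub_nonneg.2 hq.le)
    linarith
  have l1 := congrArg Real.log e1
  have l2 := congrArg Real.log e2
  rw [Real.log_mul (by linarith) (by linarith), Real.log_mul (by positivity) (by linarith),
    Real.log_pow] at l1
  rw [Real.log_mul (by linarith) (by linarith), Real.log_pow] at l2
  rw [e3, Real.log_mul (by positivity) (by linarith), Real.log_pow]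
  have hmono := Real.log_le_log (by linarith) hps
  have hlog0 := Real.log_nonneg hpn
  have hn' : (0 : ℝ) < n := by exact_mod_cast hn
  have hmn : (m : ℝ) / n ≤ 1 := by
    rw [div_le_one hn']
    exact_mod_cast hcard
  have : (m : ℝ) * ((n * Real.log Q + Real.log (1 + (q - 1) * u ^ n)) / n - Real.log q) =
      m * Real.log Q + m / n * Real.log (1 + (q - 1) * u ^ n) - m * Real.log q := by
    field_simp
  rw [this]
  nlinarith [mul_le_mul_of_nonneg_right hmn hlog0]

/-- The mean weight of a codeword drawn with probability proportional to `z ^ wt x`. -/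
def meanWeight (A : Finset (ι → K)) (z : ℝ) : ℝ :=
  (∑ x ∈ A, (hammingNorm x : ℝ) * z ^ hammingNorm x) / weightEnum A z

theorem weightEnum_mul_exp_le (A : Finset (ι → K)) {z θ : ℝ} (hz : 0 ≤ z)
    (hA : 0 < weightEnum A z) (hθ : |θ| * Fintype.card ι ≤ 1) :
    weightEnum A (z * Real.exp θ) ≤
      weightEnum A z * Real.exp (θ * meanWeight A z + θ ^ 2 * (Fintype.card ι : ℝ) ^ 2) := by
  have hterm : ∀ x ∈ A, (z * Real.exp θ) ^ hammingNorm x ≤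
      (1 + θ ^ 2 * (Fintype.card ι : ℝ) ^ 2) * z ^ hammingNorm x +
        θ * ((hammingNorm x : ℝ) * z ^ hammingNorm x) := by
    intro x _
    have hx : (hammingNorm x : ℝ) ≤ Fintype.card ι := by
      exact_mod_cast hammingNorm_le_card_fintype
    have habs : |(hammingNorm x : ℝ) * θ| ≤ 1 := by
      rw [abs_mul, Nat.abs_cast, mul_comm]
      exact (mul_le_mul_of_nonneg_left hx (abs_nonneg θ)).trans hθ
    have h1 := (abs_le.1 (Real.abs_exp_sub_one_sub_id_le habs)).2
    have h2 : ((hammingNorm x : ℝ) * θ) ^ 2 ≤ θ ^ 2 * (Fintype.card ι : ℝ) ^ 2 := by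
      rw [mul_pow, mul_comm]
      gcongr
    rw [mul_pow, ← Real.exp_nat_mul]
    nlinarith [mul_le_mul_of_nonneg_left (sub_nonneg.2 (h1.trans h2))
      (pow_nonneg hz (hammingNorm x))]
  have hmean : meanWeight A z * weightEnum A z =
      ∑ x ∈ A, (hammingNorm x : ℝ) * z ^ hammingNorm x := div_mul_cancel₀ _ hA.ne'
  calc weightEnum A (z * Real.exp θ)
      ≤ ∑ x ∈ A, ((1 + θ ^ 2 * (Fintype.card ι : ℝ) ^ 2) * z ^ hammingNorm x +
        θ * ((hammingNorm x : ℝ) * z ^ hammingNorm x)) := Finset.sum_le_sum hterm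
    _ = weightEnum A z * (θ * meanWeight A z + θ ^ 2 * (Fintype.card ι : ℝ) ^ 2 + 1) := by
        rw [Finset.sum_add_distrib, ← Finset.mul_sum, ← Finset.mul_sum, ← hmean]
        simp only [weightEnum]
        ring
    _ ≤ _ := mul_le_mul_of_nonneg_left (Real.add_one_le_exp _) hA.le

theorem sum_tail_le (A : Finset (ι → K)) {z : ℝ} (hz : 0 ≤ z) (θ τ : ℝ) :
    ∑ x ∈ A with 0 ≤ θ * ((hammingNorm x : ℝ) - τ), z ^ hammingNorm x ≤
      Real.exp (-(θ * τ)) * weightEnum A (z * Real.exp θ) := by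
  rw [weightEnum, Finset.mul_sum]
  refine (Finset.sum_le_sum fun x hx => ?_).trans
    (Finset.sum_le_sum_of_subset_of_nonneg (Finset.filter_subset _ _) fun x _ _ => by positivity)
  rw [mul_pow, ← Real.exp_nat_mul, mul_left_comm, ← Real.exp_add]
  refine le_mul_of_one_le_right (pow_nonneg hz _) (Real.one_le_exp ?_)
  linarith [(Finset.mem_filter.1 hx).2]

variable [Fintype G] [DecidableEq G]

/-- The mean weight of `blockParityCode g β`, as the sum of the mean weights of its blocks. -/
def blockMeanWeight (g : ι → G) (β : ι → K) (z : ℝ) : ℝ :=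
  ∑ k, meanWeight (parityCode fun i : {i // g i = k} => β i) z

theorem sum_card_fiber (g : ι → G) :
    ∑ k, (Fintype.card {i // g i = k} : ℝ) = Fintype.card ι := by
  rw [← Nat.cast_sum, ← Fintype.card_sigma, Fintype.card_congr (Equiv.sigmaFiberEquiv g)]

theorem one_le_weightEnum_blockParityCode (g : ι → G) (β : ι → K) {z : ℝ} (hz : 0 ≤ z) :
    1 ≤ weightEnum (blockParityCode g β) z := by
  rw [weightEnum_blockParityCode]
  exact Finset.prod_induction _ (fun a => 1 ≤ a) (fun _ _ => one_le_mul_of_one_le_of_one_le) le_rfl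
    fun k _ => one_le_weightEnum_parityCode _ hz

theorem log_parityPoly_le_log_weightEnum {n : ℕ} (hn : 0 < n) (g : ι → G) (β : ι → K)
    (hcard : ∀ k, Fintype.card {i // g i = k} ≤ n) (hβ : ∀ i, ∃ i', g i' = g i ∧ β i' ≠ 0)
    {z : ℝ} (hz : z ∈ Set.Ioc (0 : ℝ) 1) :
    (Fintype.card ι : ℝ) * (Real.log (parityPoly (Fintype.card K) n z) / n -
        Real.log (Fintype.card K)) ≤
      Real.log (weightEnum (blockParityCode g β) z) -
        Real.log (blockParityCode g β).card := by
  rw [← weightEnum_one, weightEnum_blockParityCode, weightEnum_blockParityCode,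
    Real.log_prod fun k _ => (zero_lt_one.trans_le (one_le_weightEnum_parityCode _ hz.1.le)).ne',
    Real.log_prod fun k _ => (zero_lt_one.trans_le
      (one_le_weightEnum_parityCode _ zero_le_one)).ne',
    ← Finset.sum_sub_distrib, ← sum_card_fiber g, Finset.sum_mul]
  refine Finset.sum_le_sum fun k _ =>
    log_parityPoly_le_log_weightEnum_parityCode hn _ (hcard k) ?_ hz
  rintro ⟨i, hi⟩ h0
  obtain ⟨i', hi', hne⟩ := hβ i
  exact hne (congrFun h0 ⟨i', hi'.trans hi⟩)

theorem weightEnum_blockParityCode_mul_exp_le {n : ℕ} (g : ι → G) (β : ι → K)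
    (hcard : ∀ k, Fintype.card {i // g i = k} ≤ n) {z θ : ℝ} (hz : 0 ≤ z) (hθ : |θ| * n ≤ 1) :
    weightEnum (blockParityCode g β) (z * Real.exp θ) ≤
      weightEnum (blockParityCode g β) z *
        Real.exp (θ * blockMeanWeight g β z + θ ^ 2 * (n * Fintype.card ι)) := by
  have hc : ∀ k, (Fintype.card {i // g i = k} : ℝ) ≤ n := fun k => by exact_mod_cast hcard k
  calc weightEnum (blockParityCode g β) (z * Real.exp θ)
      ≤ ∏ k, (weightEnum (parityCode fun i : {i // g i = k} => β i) z *
          Real.exp (θ * meanWeight (parityCode fun i : {i // g i = k} => β i) z +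
            θ ^ 2 * (n * Fintype.card {i // g i = k}))) := by
        rw [weightEnum_blockParityCode]
        refine Finset.prod_le_prod (fun k _ => ?_) fun k _ => ?_
        · exact zero_le_one.trans (one_le_weightEnum_parityCode _ (by positivity))
        · have hpos := zero_lt_one.trans_le
            (one_le_weightEnum_parityCode (fun i : {i // g i = k} => β i) hz)
          refine (weightEnum_mul_exp_le _ hz hpos
            ((mul_le_mul_of_nonneg_left (hc k) (abs_nonneg θ)).trans hθ)).trans ?_
          have := hc k
          rw [sq (Fintype.card {i // g i = k} : ℝ)]
          gcongr
    _ = _ := by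
        rw [Finset.prod_mul_distrib, ← weightEnum_blockParityCode, ← Real.exp_sum,
          Finset.sum_add_distrib, ← Finset.mul_sum, ← Finset.mul_sum, ← Finset.mul_sum,
          sum_card_fiber, blockMeanWeight]

theorem blockMeanWeight_zero (g : ι → G) (β : ι → K) : blockMeanWeight g β 0 = 0 := by
  refine Finset.sum_eq_zero fun k _ => ?_
  rw [meanWeight, Finset.sum_eq_zero, zero_div]
  intro x _
  rcases eq_or_ne (hammingNorm x) 0 with h | h <;> simp [h]

theorem continuousOn_blockMeanWeight (g : ι → G) (β : ι → K) :
    ContinuousOn (blockMeanWeight g β) (Set.Icc 0 1) := by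
  refine continuousOn_finsetSum _ fun k _ => ContinuousOn.div (by fun_prop) ?_ fun z hz =>
    (zero_lt_one.trans_le (one_le_weightEnum_parityCode _ hz.1)).ne'
  unfold weightEnum
  fun_prop

theorem exists_tilt (g : ι → G) (β : ι → K) {μ : ℝ} (hμ : 0 < μ) :
    ∃ z ∈ Set.Ioc (0 : ℝ) 1, blockMeanWeight g β z ≤ μ ∧ (z = 1 ∨ blockMeanWeight g β z = μ) := by
  rcases le_or_gt (blockMeanWeight g β 1) μ with h | h
  · exact ⟨1, ⟨one_pos, le_rfl⟩, h, Or.inl rfl⟩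
  · obtain ⟨z, hz, hzμ⟩ := intermediate_value_Icc zero_le_one (continuousOn_blockMeanWeight g β)
      (show μ ∈ Set.Icc _ _ from ⟨(blockMeanWeight_zero g β).trans_le hμ.le, h.le⟩)
    refine ⟨z, ⟨lt_of_le_of_ne hz.1 ?_, hz.2⟩, hzμ.le, Or.inr hzμ⟩
    rintro rfl
    rw [blockMeanWeight_zero] at hzμ
    exact hμ.ne hzμ

/-- Large-deviation lower bound for the number of codewords of small weight. -/
theorem exists_weightEnum_le_card_ball {n : ℕ} (hn : 0 < n) (g : ι → G) (β : ι → K)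
    (hcard : ∀ k, Fintype.card {i // g i = k} ≤ n) {ρ ε : ℝ} (hε : 0 < ε) (hε1 : ε ≤ 1)
    (hρ : 2 * ε < ρ) (hι : 0 < Fintype.card ι)
    (hlarge : Real.exp (-(ε ^ 2 / (4 * n) * Fintype.card ι)) ≤ 1 / 4) :
    ∃ z ∈ Set.Ioc (0 : ℝ) 1,
      weightEnum (blockParityCode g β) z ≤
        2 * (((blockParityCode g β).filter fun x =>
            (hammingNorm x : ℝ) ≤ ρ * Fintype.card ι).card *
          z ^ ((ρ - 2 * ε) * Fintype.card ι)) := by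
  have hNpos : (0 : ℝ) < Fintype.card ι := by exact_mod_cast hι
  set N : ℝ := ((Fintype.card ι : ℕ) : ℝ)
  have hnpos : (0 : ℝ) < n := by exact_mod_cast hn
  obtain ⟨z, hz, hmean, hcase⟩ :=
    exists_tilt g β (μ := (ρ - ε) * N) (mul_pos (by linarith) hNpos)
  refine ⟨z, hz, ?_⟩
  set L := blockParityCode g β
  set W := weightEnum L z
  have hWpos : 0 < W := zero_lt_one.trans_le (one_le_weightEnum_blockParityCode g β hz.1.le)
  have tail : ∀ θ τ : ℝ, |θ| = ε / (2 * n) →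
      θ * blockMeanWeight g β z ≤ θ * τ - ε / (2 * n) * (ε * N) →
      ∑ x ∈ L with 0 ≤ θ * ((hammingNorm x : ℝ) - τ), z ^ hammingNorm x ≤ W / 4 := by
    intro θ τ hθ hτ
    have hθn : |θ| * n ≤ 1 := by
      rw [hθ]
      field_simp
      linarith
    have hθ2 : θ ^ 2 * (n * N) = ε ^ 2 / (4 * n) * N := by
      rw [← sq_abs, hθ]
      field_simp
      norm_num
    calc _ ≤ Real.exp (-(θ * τ)) * weightEnum L (z * Real.exp θ) := sum_tail_le L hz.1.le θ τ
      _ ≤ Real.exp (-(θ * τ)) *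
          (W * Real.exp (θ * blockMeanWeight g β z + θ ^ 2 * (n * N))) := by
        gcongr
        exact weightEnum_blockParityCode_mul_exp_le g β hcard hz.1.le hθn
      _ = W * Real.exp (-(θ * τ) + (θ * blockMeanWeight g β z + θ ^ 2 * (n * N))) := by
        rw [Real.exp_add (-(θ * τ))]
        ring
      _ ≤ W * (1 / 4) := by
        refine mul_le_mul_of_nonneg_left ((Real.exp_le_exp.2 ?_).trans hlarge) hWpos.le
        rw [hθ2]
        have : ε / (2 * n) * (ε * N) = 2 * (ε ^ 2 / (4 * n) * N) := by
          field_simp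
          norm_num
        linarith
      _ = W / 4 := by ring
  have hc0 : 0 < ε / (2 * n) := by positivity
  have upper : ∑ x ∈ L with ¬ (hammingNorm x : ℝ) ≤ ρ * N, z ^ hammingNorm x ≤ W / 4 := by
    refine (Finset.sum_le_sum_of_subset_of_nonneg ?_ fun x _ _ => pow_nonneg hz.1.le _).trans
      (tail (ε / (2 * n)) (ρ * N) (abs_of_pos hc0) ?_)
    · intro x hx
      rw [Finset.mem_filter] at hx ⊢
      exact ⟨hx.1, mul_nonneg hc0.le (by linarith [not_le.1 hx.2])⟩
    · nlinarith [mul_le_mul_of_nonneg_left hmean hc0.le]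
  set B := L.filter fun x => (hammingNorm x : ℝ) ≤ ρ * N
  have hsplit : ∑ x ∈ B, z ^ hammingNorm x +
      ∑ x ∈ L with ¬ (hammingNorm x : ℝ) ≤ ρ * N, z ^ hammingNorm x = W :=
    Finset.sum_filter_add_sum_filter_not L _ _
  have hB : W / 2 ≤ B.card * z ^ ((ρ - 2 * ε) * N) := by
    rcases hcase with rfl | hcase
    · simp only [one_pow, Finset.sum_const, nsmul_eq_mul, mul_one] at hsplit upper
      rw [Real.one_rpow]
      linarith
    · have lower : ∑ x ∈ B with (hammingNorm x : ℝ) ≤ (ρ - 2 * ε) * N, z ^ hammingNorm x ≤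
          W / 4 := by
        refine (Finset.sum_le_sum_of_subset_of_nonneg ?_ fun x _ _ => pow_nonneg hz.1.le _).trans
          (tail (-(ε / (2 * n))) ((ρ - 2 * ε) * N) (by rw [abs_neg, abs_of_pos hc0]) ?_)
        · intro x hx
          rw [Finset.mem_filter] at hx ⊢
          refine ⟨Finset.filter_subset _ _ hx.1, mul_nonneg_of_nonpos_of_nonpos ?_ ?_⟩ <;>
            linarith [hx.2]
        · rw [hcase]
          apply le_of_eq
          ring
      have hsplitB := Finset.sum_filter_add_sum_filter_not B
        (fun x => (hammingNorm x : ℝ) ≤ (ρ - 2 * ε) * N) fun x => z ^ hammingNorm x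
      have window : ∑ x ∈ B with ¬ (hammingNorm x : ℝ) ≤ (ρ - 2 * ε) * N, z ^ hammingNorm x ≤
          B.card * z ^ ((ρ - 2 * ε) * N) := by
        refine (Finset.sum_le_card_nsmul _ _ (z ^ ((ρ - 2 * ε) * N)) fun x hx => ?_).trans ?_
        · rw [← Real.rpow_natCast]
          exact Real.rpow_le_rpow_of_exponent_ge hz.1 hz.2
            (not_le.1 (Finset.mem_filter.1 hx).2).le
        · rw [nsmul_eq_mul]
          have := Real.rpow_nonneg hz.1.le ((ρ - 2 * ε) * N)
          gcongr
          exact Finset.filter_subset _ _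
      linarith
  linarith

end BlockBounds

section SpherePacking

variable {K ι G : Type} [Field K] [Fintype K] [DecidableEq K] [Fintype ι] [Fintype G]
  [DecidableEq G]

theorem mem_blockParityCode {g : ι → G} {β x : ι → K} :
    x ∈ blockParityCode g β ↔ ∀ k, ∑ i : {i // g i = k}, β i * x i = 0 := by
  simp [blockParityCode, mem_parityCode]

theorem add_mem_blockParityCode {g : ι → G} {β x y : ι → K} (hx : x ∈ blockParityCode g β)
    (hy : y ∈ blockParityCode g β) : x + y ∈ blockParityCode g β := by
  rw [mem_blockParityCode] at *
  intro k
  simp_rw [Pi.add_apply, mul_add, Finset.sum_add_distrib, hx k, hy k, add_zero]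

/-- Hamming's bound inside the ambient code `blockParityCode g β`. -/
theorem ncard_mul_card_ball_le (g : ι → G) (β : ι → K) {C : Set (ι → K)}
    (hC : ∀ c ∈ C, c ∈ blockParityCode g β) {t : ℝ}
    (hdist : ∀ c ∈ C, ∀ c' ∈ C, c ≠ c' → 2 * t < hammingDist c c') :
    C.ncard * ((blockParityCode g β).filter fun x => (hammingNorm x : ℝ) ≤ t).card ≤
      (blockParityCode g β).card := by
  classical
  rw [Set.ncard_eq_toFinset_card C C.toFinite, ← Finset.card_product]
  refine Finset.card_le_card_of_injOn (fun p => p.1 + p.2) ?_ ?_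
  · rintro ⟨c, x⟩ h
    simp only [Finset.coe_product, Set.mem_prod, Finset.mem_coe, Set.Finite.mem_toFinset,
      Finset.mem_filter] at h
    exact add_mem_blockParityCode (hC c h.1) h.2.1
  · rintro ⟨c, x⟩ h ⟨c', x'⟩ h' heq
    simp only [Finset.coe_product, Set.mem_prod, Finset.mem_coe, Set.Finite.mem_toFinset,
      Finset.mem_filter] at h h' heq
    have hcc : c = c' := by
      by_contra hne
      have h1 := hdist c h.1 c' h'.1 hne
      have h2 : hammingDist c c' = hammingDist x' x := by
        have hsub : c - c' = x' - x := by
          rw [sub_eq_sub_iff_add_eq_add, heq, add_comm]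
        have hiff : ∀ i, c i ≠ c' i ↔ x' i ≠ x i := fun i => by
          rw [← sub_ne_zero, ← Pi.sub_apply, hsub, Pi.sub_apply, sub_ne_zero]
        simp only [hammingDist, hiff]
      have h3 : (hammingDist x' x : ℝ) ≤ hammingNorm x' + hammingNorm x := by
        have := hammingDist_triangle x' 0 x
        rw [hammingDist_zero_right, hammingDist_zero_left] at this
        exact_mod_cast this
      rw [h2] at h1
      linarith [h.2.2, h'.2.2]
    subst hcc
    rw [add_left_cancel heq]

end SpherePacking

section RateBound

variable {K ι G : Type} [Field K] [Fintype K] [DecidableEq K] [Fintype ι] [Fintype G]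
  [DecidableEq G]

theorem le_R0 {q : ℕ} (hq : 2 ≤ q) {n : ℕ} (hn : 0 < n) {ω : ℝ} (hω : 0 ≤ ω) {z : ℝ}
    (hz : z ∈ Set.Ioc (0 : ℝ) 1) :
    1 - Real.logb q (parityPoly q n z) / n + ω * Real.logb q z ≤ R0 q ω n := by
  have hq1 : (1 : ℝ) < q := by exact_mod_cast hq
  have hn' : (0 : ℝ) < n := by exact_mod_cast hn
  have hle : lambdaQ q ω n ≤
      -ω * Real.logb q z - 1 / n + (1 / n) * Real.logb q (parityPoly q n z) := by
    refine ciInf_le ⟨-(1 / (n : ℝ)), ?_⟩ (⟨z, hz⟩ : Set.Ioc (0 : ℝ) 1)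
    rintro _ ⟨w, rfl⟩
    have h1 : Real.logb q (w : ℝ) ≤ 0 := Real.logb_nonpos hq1 w.2.1.le w.2.2
    have h2 : 0 ≤ Real.logb q (parityPoly q n w) :=
      Real.logb_nonneg hq1 (one_le_parityPoly (by omega) n w.2)
    have h3 : 0 ≤ (1 / (n : ℝ)) * Real.logb q (parityPoly q n w) := by positivity
    rw [parityPoly] at h3
    dsimp only
    nlinarith [mul_nonneg hω (neg_nonneg.2 h1)]
  have : ((n : ℝ) - 1) / n = 1 - 1 / n := by field_simp
  rw [R0, this]
  have e : Real.logb q (parityPoly q n z) / n = (1 / n) * Real.logb q (parityPoly q n z) := by ring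
  linarith

theorem R0_nonneg {q : ℕ} (hq : 2 ≤ q) {n : ℕ} (hn : 0 < n) {ω : ℝ} (hω : 0 ≤ ω) :
    0 ≤ R0 q ω n := by
  have h := le_R0 hq hn hω (z := 1) ⟨one_pos, le_rfl⟩
  have hq1 : (1 : ℝ) < q := by exact_mod_cast hq
  have hn' : (n : ℝ) ≠ 0 := by exact_mod_cast hn.ne'
  have e : parityPoly q n 1 = (q : ℝ) ^ n := by simp [parityPoly, hn.ne']
  rw [e, Real.logb_pow, Real.logb_self_eq_one hq1, Real.logb_one] at h
  field_simp at h
  linarith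

/-- Shrinking the radius parameter from `ω` to `ω - s` costs at most `s / ω` in the rate. -/
theorem le_R0_add {q : ℕ} (hq : 2 ≤ q) {n : ℕ} (hn : 0 < n) {ω s : ℝ} (hω : 0 < ω) (hs : 0 ≤ s)
    (hsω : s ≤ ω) {z : ℝ} (hz : z ∈ Set.Ioc (0 : ℝ) 1) :
    1 - Real.logb q (parityPoly q n z) / n + (ω - s) * Real.logb q z ≤ R0 q ω n + s / ω := by
  have hq1 : (1 : ℝ) < q := by exact_mod_cast hq
  have h1 := le_R0 hq hn hω.le hz
  have h0 := R0_nonneg hq hn hω.le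
  have hA : 0 ≤ Real.logb q (parityPoly q n z) / n :=
    div_nonneg (Real.logb_nonneg hq1 (one_le_parityPoly (by omega) n hz)) (Nat.cast_nonneg n)
  set A := Real.logb q (parityPoly q n z) / n
  set l := Real.logb q z
  have hr0 : 0 ≤ s / ω := div_nonneg hs hω.le
  have hr1 : s / ω ≤ 1 := (div_le_one hω).2 hsω
  have e : 1 - A + (ω - s) * l = (1 - s / ω) * (1 - A + ω * l) + s / ω * (1 - A) := by
    field_simp
    ring
  rw [e]
  nlinarith [mul_le_mul_of_nonneg_left h1 (sub_nonneg.2 hr1), mul_nonneg hr0 h0,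
    mul_nonneg hr0 hA]

theorem logb_ncard_le {n : ℕ} (hn : 0 < n) (g : ι → G) (β : ι → K)
    (hcard : ∀ k, Fintype.card {i // g i = k} ≤ n) (hβ : ∀ i, ∃ i', g i' = g i ∧ β i' ≠ 0)
    {C : Set (ι → K)} (hne : C.Nonempty) (hC : ∀ c ∈ C, c ∈ blockParityCode g β)
    {ω ε : ℝ} (hε : 0 < ε) (hε1 : ε ≤ 1) (hω : 3 * ε < ω) (hι : 0 < Fintype.card ι)
    (hlarge : Real.exp (-(ε ^ 2 / (4 * n) * Fintype.card ι)) ≤ 1 / 4)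
    (hdist : ∀ c ∈ C, ∀ c' ∈ C, c ≠ c' →
      2 * ((ω - ε) * Fintype.card ι) < hammingDist c c') :
    Real.logb (Fintype.card K) C.ncard ≤ Real.logb (Fintype.card K) 2 +
      Fintype.card ι * (R0 (Fintype.card K) ω n + 3 * ε / ω) := by
  have hqn : 1 < Fintype.card K := Fintype.one_lt_card
  have hlogq : 0 < Real.log (Fintype.card K) := Real.log_pos (by exact_mod_cast hqn)
  obtain ⟨z, hz, hball⟩ := exists_weightEnum_le_card_ball hn g β hcard (ρ := ω - ε) hε hε1
    (by linarith) hι hlarge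
  have hpack := ncard_mul_card_ball_le g β hC hdist
  have hL := log_parityPoly_le_log_weightEnum hn g β hcard hβ hz
  have hW := one_le_weightEnum_blockParityCode g β hz.1.le
  have hR := le_R0_add hqn hn (s := 3 * ε) (by linarith : 0 < ω) (by linarith) hω.le hz
  set B := (blockParityCode g β).filter fun x => (hammingNorm x : ℝ) ≤ (ω - ε) * Fintype.card ι
  have hB : B.card ≠ 0 := by
    intro h
    rw [h] at hball
    norm_num at hball
    linarith
  have hBr : (B.card : ℝ) ≠ 0 := by exact_mod_cast hB
  have hCr : (C.ncard : ℝ) ≠ 0 := by exact_mod_cast ((Set.ncard_pos C.toFinite).2 hne).ne'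
  have hz0 : z ^ ((ω - ε - 2 * ε) * Fintype.card ι) ≠ 0 := (Real.rpow_pos_of_pos hz.1 _).ne'
  have l1 := Real.log_le_log (by linarith) hball
  rw [Real.log_mul two_ne_zero (mul_ne_zero hBr hz0), Real.log_mul hBr hz0,
    Real.log_rpow hz.1] at l1
  have l2 : Real.log C.ncard + Real.log B.card ≤ Real.log (blockParityCode g β).card := by
    rw [← Real.log_mul hCr hBr]
    exact Real.log_le_log (by positivity) (by exact_mod_cast hpack)
  have l3 := mul_le_mul_of_nonneg_left hR
    (mul_nonneg (Nat.cast_nonneg (α := ℝ) (Fintype.card ι)) hlogq.le)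
  have e1 : Real.logb (Fintype.card K) (parityPoly (Fintype.card K) n z) *
    Real.log (Fintype.card K) = Real.log (parityPoly (Fintype.card K) n z) :=
    div_mul_cancel₀ _ hlogq.ne'
  have e2 : Real.logb (Fintype.card K) z * Real.log (Fintype.card K) = Real.log z :=
    div_mul_cancel₀ _ hlogq.ne'
  have l4 : (Fintype.card ι : ℝ) * Real.log (Fintype.card K) *
      (1 - Real.logb (Fintype.card K) (parityPoly (Fintype.card K) n z) / n +
        (ω - 3 * ε) * Real.logb (Fintype.card K) z) =
      Fintype.card ι * (Real.log (Fintype.card K) -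
        Real.log (parityPoly (Fintype.card K) n z) / n + (ω - 3 * ε) * Real.log z) := by
    rw [← e1, ← e2]
    ring
  rw [l4] at l3
  rw [Real.logb, Real.logb, div_add' _ _ _ hlogq.ne']
  refine div_le_div_of_nonneg_right ?_ hlogq.le
  linarith

theorem logb_ncard_le_of_ambient {n : ℕ} (hn : 0 < n) (g : ι → G) (β : ι → K)
    (hcard : ∀ k, Fintype.card {i // g i = k} ≤ n) (hβ : ∀ i, ∃ i', g i' = g i ∧ β i' ≠ 0)
    {C : Set (ι → K)} (hne : C.Nonempty) (hC : ∀ c ∈ C, c ∈ blockParityCode g β)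
    {z : ℝ} (hz : z ∈ Set.Ioc (0 : ℝ) 1) :
    Real.logb (Fintype.card K) C.ncard ≤ Fintype.card ι * (R0 (Fintype.card K) 0 n +
      Real.logb (Fintype.card K) (1 + ((Fintype.card K : ℝ) - 1) * z)) := by
  have hqn : 1 < Fintype.card K := Fintype.one_lt_card
  have hlogq : 0 < Real.log (Fintype.card K) := Real.log_pos (by exact_mod_cast hqn)
  have hL := log_parityPoly_le_log_weightEnum hn g β hcard hβ hz
  have hW := one_le_weightEnum_blockParityCode g β hz.1.le
  have hR := le_R0 hqn hn le_rfl hz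
  have l1 := Real.log_le_log (by linarith) (weightEnum_le (blockParityCode g β) hz.1.le)
  rw [Real.log_pow] at l1
  have l2 : Real.log C.ncard ≤ Real.log (blockParityCode g β).card := by
    refine Real.log_le_log (by exact_mod_cast (Set.ncard_pos C.toFinite).2 hne) ?_
    rw [← Set.ncard_coe_finset]
    exact_mod_cast Set.ncard_le_ncard (fun c hc => hC c hc) (Finset.finite_toSet _)
  have l3 := mul_le_mul_of_nonneg_left hR
    (mul_nonneg (Nat.cast_nonneg (α := ℝ) (Fintype.card ι)) hlogq.le)
  have e1 : Real.logb (Fintype.card K) (parityPoly (Fintype.card K) n z) *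
    Real.log (Fintype.card K) = Real.log (parityPoly (Fintype.card K) n z) :=
    div_mul_cancel₀ _ hlogq.ne'
  have l4 : (Fintype.card ι : ℝ) * Real.log (Fintype.card K) *
      (1 - Real.logb (Fintype.card K) (parityPoly (Fintype.card K) n z) / n +
        0 * Real.logb (Fintype.card K) z) =
      Fintype.card ι * (Real.log (Fintype.card K) -
        Real.log (parityPoly (Fintype.card K) n z) / n) := by
    rw [← e1]
    ring
  rw [l4] at l3
  rw [Real.logb, div_le_iff₀ hlogq]
  have e2 : Real.logb (Fintype.card K) (1 + ((Fintype.card K : ℝ) - 1) * z) *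
    Real.log (Fintype.card K) = Real.log (1 + ((Fintype.card K : ℝ) - 1) * z) :=
    div_mul_cancel₀ _ hlogq.ne'
  rw [mul_assoc, add_mul, e2]
  linarith

end RateBound

/-- An all-disjoint linearly recoverable LRC lies in a direct sum of parity codes supported on its
repair groups. -/
theorem exists_subset_blockParityCode {K : Type} [Field K] [Fintype K] [DecidableEq K] {N n : ℕ}
    {C : Set (Fin N → K)} {Rg : Fin N → Finset (Fin N)} (hLRC : IsLinRecLRC C n Rg)
    (hdisj : IsAllDisjoint Rg) :
    (∀ k, Fintype.card {i // Rg i = k} ≤ n) ∧ ∃ β : Fin N → K,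
      (∀ i, ∃ i', Rg i' = Rg i ∧ β i' ≠ 0) ∧ ∀ c ∈ C, c ∈ blockParityCode Rg β := by
  have hgroup : ∀ i j, i ∈ Rg j → Rg i = Rg j := fun i j hij =>
    (hdisj i j).resolve_right (Finset.not_disjoint_iff.2 ⟨i, (hLRC i).1, hij⟩)
  constructor
  · intro k
    rcases isEmpty_or_nonempty {i // Rg i = k} with h | ⟨⟨j, hj⟩⟩
    · simp
    · refine le_trans ?_ (hLRC j).2.1
      rw [Fintype.card_subtype, hj]
      refine Finset.card_le_card fun i hi => ?_
      rw [← (Finset.mem_filter.1 hi).2]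
      exact (hLRC i).1
  · choose a ha hrec using fun j => (hLRC j).2.2
    let r : Fin N → Fin N := fun i => Set.rangeSplitting Rg ⟨Rg i, Set.mem_range_self i⟩
    have hr : ∀ i, Rg (r i) = Rg i := fun i => Set.apply_rangeSplitting Rg _
    have hr_congr : ∀ i j, Rg i = Rg j → r i = r j := fun i j hij => by simp only [r, hij]
    refine ⟨fun i => a (r i) i - (Pi.single (r i) 1 : Fin N → K) i, fun i => ⟨r i, hr i, ?_⟩,
      fun c hc => ?_⟩
    · beta_reduce
      rw [hr_congr _ _ (hr i), ha (r i) (r i) (Finset.notMem_erase _ _)]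
      simp
    · rw [mem_blockParityCode]
      intro k
      rcases isEmpty_or_nonempty {i // Rg i = k} with h | ⟨⟨j, hj⟩⟩
      · exact Finset.sum_of_isEmpty _
      set s := r j
      have hsj : Rg s = k := (hr j).trans hj
      calc ∑ i : {i // Rg i = k}, (a (r i) i - (Pi.single (r i) 1 : Fin N → K) i) * c i
          = ∑ i : {i // Rg i = k}, (a s i - (Pi.single s 1 : Fin N → K) i) * c i :=
            Finset.sum_congr rfl fun i _ => by rw [hr_congr i j (i.2.trans hj.symm)]
        _ = ∑ i with Rg i = k, (a s i - (Pi.single s 1 : Fin N → K) i) * c i :=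
            (Finset.sum_subtype _ (p := fun i => Rg i = k) (fun i => by simp)
              fun i => (a s i - (Pi.single s 1 : Fin N → K) i) * c i).symm
        _ = ∑ i, (a s i - (Pi.single s 1 : Fin N → K) i) * c i := by
            refine Finset.sum_subset (Finset.filter_subset _ _) fun i _ hi => ?_
            have hik : Rg i ≠ k := by simpa using hi
            have his : i ≠ s := by
              rintro rfl
              exact hik hsj
            have hmem : i ∉ (Rg s).erase s := fun hmem =>
              hik ((hgroup i s (Finset.mem_of_mem_erase hmem)).trans hsj)
            rw [ha s i hmem, Pi.single_eq_of_ne his]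
            ring
        _ = 0 := by
            simp_rw [sub_mul, Finset.sum_sub_distrib, ← hrec s c hc, Pi.single_apply, ite_mul,
              zero_mul, one_mul]
            simp

theorem lt_hammingDist_of_lt_minDist {K : Type} [DecidableEq K] {ι : Type} [Fintype ι]
    {C : Set (ι → K)} {t : ℝ} (ht : t < minDist C) {c c' : ι → K} (hc : c ∈ C) (hc' : c' ∈ C)
    (hne : c ≠ c') : t < hammingDist c c' :=
  ht.trans_le (Nat.cast_le.2 (Nat.sInf_le ⟨c, hc, c', hc', hne, rfl⟩))

/-- Asymptotic sphere-packing bound: the rate of every all-disjoint linearly recoverable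
`(δ,n)`-LRC sequence over `F` is bounded from above by `R_SP(δ,n) = R_0(δ/2,n)`. -/
theorem spherePacking
    (K : Type) [Field K] [Fintype K] [DecidableEq K]
    (q : ℕ) (hq : Fintype.card K = q)
    (n : ℕ) (hn : 2 ≤ n)
    (δ : ℝ) (hδ : δ ∈ Set.Ico (0:ℝ) (((q:ℝ) - 1) / q))
    (N : ℕ → ℕ) (C : ∀ i : ℕ, Set (Fin (N i) → K))
    (hmono : StrictMono N) (hne : ∀ i, (C i).Nonempty)
    (hLRC : ∀ i, ∃ Rg : Fin (N i) → Finset (Fin (N i)),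
      IsLinRecLRC (C i) n Rg ∧ IsAllDisjoint Rg)
    (hdist : δ ≤ liminf (fun i => (minDist (C i) : ℝ) / (N i : ℝ)) atTop) :
    limsup (fun i => Real.logb q ((C i).ncard : ℝ) / (N i : ℝ)) atTop
      ≤ R0 q (δ / 2) n := by
  subst hq
  have hqn : 1 < Fintype.card K := Fintype.one_lt_card
  have hq1 : (1 : ℝ) < Fintype.card K := by exact_mod_cast hqn
  have hn0 : 0 < n := by omega
  have hNtop : Tendsto (fun i => (N i : ℝ)) atTop atTop :=
    tendsto_natCast_atTop_atTop.comp hmono.tendsto_atTop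
  have hrate : ∀ i, 0 ≤ Real.logb (Fintype.card K) (C i).ncard / N i := fun i =>
    div_nonneg (Real.logb_nonneg hq1
      (by exact_mod_cast (Set.ncard_pos (C i).toFinite).2 (hne i))) (Nat.cast_nonneg _)
  have hcobdd : IsCoboundedUnder (· ≤ ·) atTop
      fun i => Real.logb (Fintype.card K) (C i).ncard / N i :=
    IsBoundedUnder.isCoboundedUnder_le (isBoundedUnder_of ⟨0, hrate⟩)
  refine le_of_forall_pos_le_add fun η hη => limsup_le_of_le hcobdd ?_
  rcases hδ.1.eq_or_lt with rfl | hδ0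
  · obtain ⟨z, hz, hzη⟩ : ∃ z ∈ Set.Ioc (0 : ℝ) 1,
        Real.logb (Fintype.card K) (1 + ((Fintype.card K : ℝ) - 1) * z) ≤ η := by
      have hcont : Tendsto
          (fun z : ℝ => Real.log (1 + ((Fintype.card K : ℝ) - 1) * z) / Real.log (Fintype.card K))
          (nhdsWithin 0 (Set.Ioi 0)) (nhds 0) := by
        have : ContinuousAt (fun z : ℝ =>
            Real.log (1 + ((Fintype.card K : ℝ) - 1) * z) / Real.log (Fintype.card K)) 0 :=
          ((ContinuousAt.log (by fun_prop) (by simp)).div_const _)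
        simpa using this.tendsto.mono_left nhdsWithin_le_nhds
      obtain ⟨z, hzη, hz⟩ := ((hcont.eventually (gt_mem_nhds hη)).and
        (Ioc_mem_nhdsGT one_pos)).exists
      exact ⟨z, hz, hzη.le⟩
    filter_upwards [hNtop.eventually_gt_atTop 0] with i hi
    obtain ⟨Rg, hRg, hdisj⟩ := hLRC i
    obtain ⟨hcard, β, hβ, hC⟩ := exists_subset_blockParityCode hRg hdisj
    have h := logb_ncard_le_of_ambient hn0 Rg β hcard hβ (hne i) hC hz
    rw [Fintype.card_fin] at h
    rw [zero_div, div_le_iff₀ hi, mul_comm]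
    exact h.trans (by gcongr)
  · set ω := δ / 2 with hω
    have hω0 : 0 < ω := by positivity
    obtain ⟨ε, hε, hε1, hεω, hεη⟩ : ∃ ε : ℝ, 0 < ε ∧ ε ≤ 1 ∧ 3 * ε < ω ∧ 3 * ε / ω ≤ η / 2 := by
      refine ⟨min 1 (min (ω / 6) (η * ω / 6)), by positivity, min_le_left _ _, ?_, ?_⟩
      · have := (min_le_right 1 (min (ω / 6) (η * ω / 6))).trans (min_le_left _ _)
        linarith
      · have := (min_le_right 1 (min (ω / 6) (η * ω / 6))).trans (min_le_right _ _)
        rw [div_le_iff₀ hω0]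
        linarith
    have hexp : ∀ᶠ i in atTop, Real.exp (-(ε ^ 2 / (4 * n) * N i)) ≤ 1 / 4 := by
      have hc : (0 : ℝ) < ε ^ 2 / (4 * n) := by positivity
      exact ((Real.tendsto_exp_neg_atTop_nhds_zero.comp
        (hNtop.const_mul_atTop hc)).eventually (gt_mem_nhds (by norm_num))).mono fun i hi => hi.le
    have hdiste : ∀ᶠ i in atTop, 2 * (ω - ε) < (minDist (C i) : ℝ) / N i := by
      refine eventually_lt_of_lt_liminf (lt_of_lt_of_le (by linarith) hdist) ?_
      exact isBoundedUnder_of ⟨0, fun i => by positivity⟩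
    filter_upwards [hNtop.eventually_gt_atTop 0, hexp, hdiste, hNtop.eventually_ge_atTop
      (Real.logb (Fintype.card K) 2 / (η / 2))] with i hi hexpi hdisti htwo
    obtain ⟨Rg, hRg, hdisj⟩ := hLRC i
    obtain ⟨hcard, β, hβ, hC⟩ := exists_subset_blockParityCode hRg hdisj
    rw [lt_div_iff₀ hi] at hdisti
    have h := logb_ncard_le hn0 Rg β hcard hβ (hne i) hC hε hε1 hεω
      (by rw [Fintype.card_fin]; exact_mod_cast hi) (by rwa [Fintype.card_fin])
      fun c hc c' hc' hcc => lt_hammingDist_of_lt_minDist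
        (by rw [Fintype.card_fin]; linarith) hc hc' hcc
    rw [Fintype.card_fin] at h
    rw [div_le_iff₀ (by positivity)] at htwo
    rw [div_le_iff₀ hi]
    nlinarith [mul_le_mul_of_nonneg_left hεη hi.le]
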